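/- For any fixed m, any fixed k < m, and any fixed p⃗ ∈ (0,1)^m, there exist constants c, C > 0 such that for all n ≥ 1, Pr_{P∼(π_{p⃗})^n}( top_k(p⃗) ⊆ CORE(P) ) ≥ 1 − C·e^{−c·n}. -/

import Mathlib

/-- Probability of an approval set `A` under the independent approval distribution
`π_{p⃗}`: each alternative `i` is approved independently with probability `p i`. -/
noncomputable def iadProb (m : ℕ) (p : Fin m → ℝ) (A : Finset (Fin m)) : ℝ :=
  (∏ i ∈ A, p i) * ∏ i ∈ Aᶜ, (1 - p i)

open Classical in
/-- Probability that a profile of `n` i.i.d. `π_{p⃗}` approval preferences satisfies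
the event `Ev`. -/
noncomputable def prIAD (m n : ℕ) (p : Fin m → ℝ)
    (Ev : (Fin n → Finset (Fin m)) → Prop) : ℝ :=
  ∑ P : Fin n → Finset (Fin m), if Ev P then ∏ j, iadProb m p (P j) else 0

/-- `W` is in the core of the profile `P` of `n` agents. -/
def inCore (m k n : ℕ) (P : Fin n → Finset (Fin m)) (W : Finset (Fin m)) : Prop :=
  ∀ (S : Finset (Fin n)) (W' : Finset (Fin m)),
    S.Nonempty → W'.card * n ≤ S.card * k →
    ∃ j ∈ S, (P j ∩ W').card ≤ (P j ∩ W).card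

open Classical in
/-- The set `top_k(p⃗)` of `k`-committees whose approval probabilities dominate all
others. -/
noncomputable def topk (m k : ℕ) (p : Fin m → ℝ) : Finset (Finset (Fin m)) :=
  Finset.univ.filter fun W : Finset (Fin m) => W.card = k ∧
    ∀ i ∈ W, ∀ j : Fin m, j ∉ W → p j ≤ p i

lemma iadProb_eq_prod {m : ℕ} (p : Fin m → ℝ) (A : Finset (Fin m)) :
    iadProb m p A = ∏ i, if i ∈ A then p i else 1 - p i := by
  rw [iadProb, ← Finset.prod_mul_prod_compl A (fun i => if i ∈ A then p i else 1 - p i)]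
  congr 1
  · exact Finset.prod_congr rfl fun i hi => by simp [hi]
  · exact Finset.prod_congr rfl fun i hi => by simp [Finset.mem_compl.mp hi]

lemma iadProb_nonneg {m : ℕ} {p : Fin m → ℝ} (hp : ∀ i, 0 ≤ p i ∧ p i ≤ 1)
    (A : Finset (Fin m)) : 0 ≤ iadProb m p A := by
  rw [iadProb_eq_prod]
  refine Finset.prod_nonneg fun i _ => ?_
  split_ifs
  · exact (hp i).1
  · linarith [(hp i).2]

lemma sum_iadProb {m : ℕ} (p : Fin m → ℝ) : ∑ A, iadProb m p A = 1 := by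
  have h := Finset.prod_add p (fun i => 1 - p i) Finset.univ
  simp only [add_sub_cancel, Finset.prod_const_one, Finset.powerset_univ] at h
  rw [h]
  exact Finset.sum_congr rfl fun A _ => by rw [iadProb, Finset.compl_eq_univ_sdiff]

/-- Expectation of `f` under the independent approval distribution. -/
noncomputable def iadExp {m : ℕ} (p : Fin m → ℝ) (f : Finset (Fin m) → ℝ) : ℝ :=
  ∑ A, iadProb m p A * f A

lemma iadExp_mono {m : ℕ} {p : Fin m → ℝ} (hp : ∀ i, 0 ≤ p i ∧ p i ≤ 1)
    {f g : Finset (Fin m) → ℝ} (h : ∀ A, f A ≤ g A) : iadExp p f ≤ iadExp p g :=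
  Finset.sum_le_sum fun A _ => mul_le_mul_of_nonneg_left (h A) (iadProb_nonneg hp A)

lemma iadExp_one {m : ℕ} (p : Fin m → ℝ) : iadExp p (fun _ => 1) = 1 := by
  simp [iadExp, sum_iadProb]

lemma iadExp_mul_one_add {m : ℕ} (p : Fin m → ℝ) (a b : ℝ) (f : Finset (Fin m) → ℝ) :
    iadExp p (fun A => a * (1 + b * f A)) = a * (1 + b * iadExp p f) := by
  calc _ = a * (iadExp p (fun _ => 1) + b * iadExp p f) := by
        simp only [iadExp, Finset.mul_sum, ← Finset.sum_add_distrib]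
        exact Finset.sum_congr rfl fun A _ => by ring
    _ = _ := by rw [iadExp_one]

/-- Conditioning on whether `i` is approved. -/
lemma iadExp_eq_sum_erase {m : ℕ} (p : Fin m → ℝ) (f : Finset (Fin m) → ℝ) (i : Fin m) :
    iadExp p f = ∑ A ∈ (Finset.univ.erase i).powerset,
      (∏ j ∈ Finset.univ.erase i, if j ∈ A then p j else 1 - p j) *
        ((1 - p i) * f A + p i * f (insert i A)) := by
  have hu : (Finset.univ : Finset (Finset (Fin m))) =
      (insert i (Finset.univ.erase i)).powerset := by
    rw [Finset.insert_erase (Finset.mem_univ i), Finset.powerset_univ]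
  rw [iadExp, hu, Finset.sum_powerset_insert (Finset.notMem_erase i _),
    ← Finset.sum_add_distrib]
  refine Finset.sum_congr rfl fun A hA => ?_
  have hi : i ∉ A := fun h => Finset.notMem_erase i _ (Finset.mem_powerset.mp hA h)
  rw [iadProb_eq_prod, iadProb_eq_prod, ← Finset.mul_prod_erase _ _ (Finset.mem_univ i),
    ← Finset.mul_prod_erase _ _ (Finset.mem_univ i)]
  have h : (∏ j ∈ Finset.univ.erase i, if j ∈ insert i A then p j else 1 - p j) =
      ∏ j ∈ Finset.univ.erase i, if j ∈ A then p j else 1 - p j :=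
    Finset.prod_congr rfl fun j hj => by simp [Finset.ne_of_mem_erase hj]
  rw [h]
  simp only [hi, if_false, Finset.mem_insert_self, if_true]
  ring

lemma iadExp_le_of_eq_off {m : ℕ} {p q : Fin m → ℝ} (hp : ∀ i, 0 ≤ p i ∧ p i ≤ 1)
    (f : Finset (Fin m) → ℝ) (i : Fin m) (hpq : ∀ j ≠ i, p j = q j)
    (h : ∀ A, 0 ≤ (q i - p i) * (f (insert i A) - f A)) : iadExp p f ≤ iadExp q f := by
  rw [iadExp_eq_sum_erase p f i, iadExp_eq_sum_erase q f i]
  refine Finset.sum_le_sum fun A _ => ?_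
  have hprod : (∏ j ∈ Finset.univ.erase i, if j ∈ A then q j else 1 - q j) =
      ∏ j ∈ Finset.univ.erase i, if j ∈ A then p j else 1 - p j :=
    Finset.prod_congr rfl fun j hj => by rw [hpq j (Finset.ne_of_mem_erase hj)]
  rw [hprod]
  refine mul_le_mul_of_nonneg_left ?_ (Finset.prod_nonneg fun j _ => ?_)
  · linarith [h A]
  · split_ifs
    · exact (hp j).1
    · linarith [(hp j).2]

/-- Shifting every approval probability in a direction in which `f` increases cannot decrease
the expectation of `f`. -/
lemma iadExp_le_iadExp {m : ℕ} {p q : Fin m → ℝ} (hp : ∀ i, 0 ≤ p i ∧ p i ≤ 1)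
    (hq : ∀ i, 0 ≤ q i ∧ q i ≤ 1) (f : Finset (Fin m) → ℝ)
    (h : ∀ i A, 0 ≤ (q i - p i) * (f (insert i A) - f A)) : iadExp p f ≤ iadExp q f := by
  have key : ∀ D : Finset (Fin m), iadExp p f ≤ iadExp (fun i => if i ∈ D then q i else p i) f := by
    intro D
    induction D using Finset.induction_on with
    | empty => simp
    | insert i D hi ih =>
      refine ih.trans (iadExp_le_of_eq_off (fun j => ?_) f i (fun j hj => ?_) fun A => ?_)
      · split_ifs
        · exact hq j
        · exact hp j
      · simp [hj]
      · simpa [hi] using h i A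
  simpa using key Finset.univ

/-- With equal approval probabilities the distribution is invariant under permutations. -/
lemma iadExp_const_map {m : ℕ} (x : ℝ) (f : Finset (Fin m) → ℝ) (σ : Equiv.Perm (Fin m)) :
    iadExp (fun _ => x) (fun A => f (A.map σ.toEmbedding)) = iadExp (fun _ => x) f := by
  refine Fintype.sum_equiv σ.finsetCongr _ _ fun A => ?_
  simp [iadProb, Finset.card_compl]

/-- A block among `r + 1` disjoint blocks of equal size has the strictly largest intersection
with an exchangeable random set with probability at most `1 / (r + 1)`. -/
lemma iadExp_const_block_le {m r a : ℕ} {x : ℝ} (hx : 0 ≤ x ∧ x ≤ 1)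
    (e : Fin (r + 1) × Fin a ↪ Fin m) :
    (r + 1) * iadExp (fun _ => x) (fun A => if ∀ j : Fin (r + 1), j ≠ 0 →
      (Finset.univ.filter fun t => e (j, t) ∈ A).card <
        (Finset.univ.filter fun t => e (0, t) ∈ A).card then 1 else 0) ≤ 1 := by
  set N : Finset (Fin m) → Fin (r + 1) → ℕ :=
    fun A j => (Finset.univ.filter fun t => e (j, t) ∈ A).card with hN
  set E : Fin (r + 1) → Finset (Fin m) → ℝ :=
    fun i A => if ∀ j, j ≠ i → N A j < N A i then 1 else 0 with hE
  have hsymm : ∀ i, iadExp (fun _ => x) (E i) = iadExp (fun _ => x) (E 0) := by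
    intro i
    let s : Equiv.Perm (Fin (r + 1)) := Equiv.swap 0 i
    let τ : Equiv.Perm (Fin (r + 1) × Fin a) := Equiv.prodCongr s (Equiv.refl _)
    let σ : Equiv.Perm (Fin m) := τ.viaFintypeEmbedding e
    have hσ : ∀ j t, σ (e (j, t)) = e (s j, t) := fun j t =>
      Equiv.Perm.viaFintypeEmbedding_apply_image τ e (j, t)
    have hNs : ∀ A j, N (A.map σ.toEmbedding) (s j) = N A j := by
      intro A j
      simp only [hN]
      congr 1
      ext t
      simp [← hσ]
    rw [← iadExp_const_map x (E i) σ]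
    congr 1
    funext A
    simp only [hE]
    have hiff : (∀ j, j ≠ i → N (A.map σ.toEmbedding) j < N (A.map σ.toEmbedding) i) ↔
        ∀ j, j ≠ 0 → N A j < N A 0 := by
      have h0 : s 0 = i := Equiv.swap_apply_left 0 i
      rw [← s.forall_congr_right]
      rw [← h0]
      simp only [hNs, ne_eq, s.injective.eq_iff]
    simp only [hiff]
  have hsum : ∑ i, iadExp (fun _ => x) (E i) ≤ 1 := by
    have hcomm : ∑ i, iadExp (fun _ : Fin m => x) (E i) =
        iadExp (fun _ => x) (fun A => ∑ i, E i A) := by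
      simp only [iadExp, Finset.mul_sum]
      exact Finset.sum_comm
    rw [hcomm, ← iadExp_one (fun _ : Fin m => x)]
    refine iadExp_mono (fun _ => hx) fun A => ?_
    simp only [hE, Finset.sum_boole]
    have : (Finset.univ.filter fun i => ∀ j, j ≠ i → N A j < N A i).card ≤ 1 := by
      refine Finset.card_le_one.mpr fun i hi j hj => ?_
      simp only [Finset.mem_filter, Finset.mem_univ, true_and] at hi hj
      by_contra hne
      exact lt_asymm (hi j (Ne.symm hne)) (hj i hne)
    exact_mod_cast this
  simp only [hsymm, Finset.sum_const, Finset.card_univ, Fintype.card_fin, nsmul_eq_mul] at hsum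
  rwa [Nat.cast_add, Nat.cast_one] at hsum

lemma exists_blocks {m r a : ℕ} {V U : Finset (Fin m)} (hVU : Disjoint V U) (hV : V.card = a)
    (hU : r * a ≤ U.card) :
    ∃ e : Fin (r + 1) × Fin a ↪ Fin m,
      (∀ v, v ∈ V ↔ ∃ t, e (0, t) = v) ∧ ∀ j : Fin (r + 1), j ≠ 0 → ∀ t, e (j, t) ∈ U := by
  let ev : Fin a ≃ V := (V.equivFinOfCardEq hV).symm
  obtain ⟨eu⟩ : Nonempty (Fin r × Fin a ↪ U) :=
    Function.Embedding.nonempty_of_card_le (by simpa using hU)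
  let g : Fin (r + 1) × Fin a → Fin m :=
    fun z => Fin.cases (ev z.2 : Fin m) (fun j => (eu (j, z.2) : Fin m)) z.1
  have hg0 : ∀ t, g (0, t) = ev t := fun t => rfl
  have hgs : ∀ j t, g (Fin.succ j, t) = eu (j, t) := fun j t => rfl
  have hne : ∀ (v : V) (u : U), (v : Fin m) ≠ u := fun v u h =>
    Finset.disjoint_left.mp hVU v.2 (h ▸ u.2)
  have hinj : Function.Injective g := by
    rintro ⟨i, s⟩ ⟨j, t⟩ h
    induction i using Fin.cases with
    | zero =>
      induction j using Fin.cases with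
      | zero =>
        rw [hg0, hg0] at h
        rw [ev.injective (Subtype.ext h)]
      | succ j => exact absurd h (hne _ _)
    | succ i =>
      induction j using Fin.cases with
      | zero => exact absurd h.symm (hne _ _)
      | succ j =>
        rw [hgs, hgs] at h
        have := eu.injective (Subtype.ext h)
        simp only [Prod.mk.injEq] at this
        rw [this.1, this.2]
  refine ⟨⟨g, hinj⟩, fun v => ⟨fun hv => ⟨ev.symm ⟨v, hv⟩, ?_⟩, ?_⟩, fun j hj t => ?_⟩
  · simp [hg0]
  · rintro ⟨t, rfl⟩
    exact (ev t).2
  · obtain ⟨j, rfl⟩ := Fin.exists_succ_eq.mpr hj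
    exact (eu (j, t)).2

/-- If the alternatives of `U` are at least as popular as those of `V`, then `V` beats `U` with
probability at most `1 / (|U| / |V| + 1)`, the inner division being rounded down. -/
lemma iadExp_beats_le {m : ℕ} {p : Fin m → ℝ} (hp : ∀ i, 0 ≤ p i ∧ p i ≤ 1)
    {V U : Finset (Fin m)} (hVU : Disjoint V U) (hV : V.Nonempty)
    (h : ∀ v ∈ V, ∀ u ∈ U, p v ≤ p u) :
    ((U.card / V.card : ℕ) + 1) *
      iadExp p (fun A => if (A ∩ U).card < (A ∩ V).card then 1 else 0) ≤ 1 := by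
  obtain ⟨v₀, hv₀, hmax⟩ := V.exists_max_image p hV
  have hins : ∀ (A X : Finset (Fin m)) (i : Fin m),
      (A ∩ X).card ≤ (insert i A ∩ X).card := fun A X i =>
    Finset.card_le_card (Finset.inter_subset_inter_right (Finset.subset_insert i A))
  have hshift : iadExp p (fun A => if (A ∩ U).card < (A ∩ V).card then 1 else 0) ≤
      iadExp (fun _ => p v₀) (fun A => if (A ∩ U).card < (A ∩ V).card then 1 else 0) := by
    refine iadExp_le_iadExp hp (fun _ => hp v₀) _ fun i A => ?_
    by_cases hiV : i ∈ V
    · have hiU : i ∉ U := Finset.disjoint_left.mp hVU hiV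
      refine mul_nonneg (sub_nonneg.mpr (hmax i hiV)) (sub_nonneg.mpr ?_)
      rw [Finset.insert_inter_of_notMem hiU]
      have := hins A V i
      split_ifs <;> first | omega | norm_num
    · rw [Finset.insert_inter_of_notMem hiV]
      by_cases hiU : i ∈ U
      · refine mul_nonneg_of_nonpos_of_nonpos (sub_nonpos.mpr (h v₀ hv₀ i hiU))
          (sub_nonpos.mpr ?_)
        have := hins A U i
        split_ifs <;> first | omega | norm_num
      · rw [Finset.insert_inter_of_notMem hiU]
        simp
  obtain ⟨e, he0, heU⟩ := exists_blocks (r := U.card / V.card) hVU rfl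
    (Nat.div_mul_le_self U.card V.card)
  refine le_trans (mul_le_mul_of_nonneg_left (hshift.trans ?_) (by positivity))
    (iadExp_const_block_le (hp v₀) e)
  refine iadExp_mono (fun _ => hp v₀) fun A => ?_
  have hblock : ∀ j, (Finset.univ.filter fun t => e (j, t) ∈ A).card =
      (A ∩ Finset.univ.map ⟨fun t => e (j, t), fun s t hst => by simpa using hst⟩).card := by
    intro j
    rw [← Finset.card_map ⟨fun t => e (j, t), fun s t hst => by simpa using hst⟩]
    congr 1
    ext x
    simp only [Finset.mem_map, Finset.mem_filter, Finset.mem_univ, true_and,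
      Finset.mem_inter]
    exact ⟨by rintro ⟨t, ht, rfl⟩; exact ⟨ht, t, rfl⟩, by rintro ⟨ht, t, rfl⟩; exact ⟨t, ht, rfl⟩⟩
  by_cases hA : (A ∩ U).card < (A ∩ V).card
  · rw [if_pos hA, if_pos]
    intro j hj
    rw [hblock, hblock]
    refine lt_of_le_of_lt (Finset.card_le_card (Finset.inter_subset_inter_left ?_))
      (hA.trans_le (Finset.card_le_card (Finset.inter_subset_inter_left ?_)))
    · intro x hx
      obtain ⟨t, -, rfl⟩ := Finset.mem_map.mp hx
      exact heU j hj t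
    · intro x hx
      obtain ⟨t, rfl⟩ := (he0 x).mp hx
      exact Finset.mem_map.mpr ⟨t, Finset.mem_univ t, rfl⟩
  · rw [if_neg hA]
    split_ifs <;> norm_num

lemma card_inter_lt_iff_sdiff {α : Type*} [DecidableEq α] (A W W' : Finset α) :
    (A ∩ W).card < (A ∩ W').card ↔ (A ∩ (W \ W')).card < (A ∩ (W' \ W)).card := by
  have key : ∀ X Y : Finset α, (A ∩ X).card = (A ∩ (X \ Y)).card + (A ∩ (X ∩ Y)).card := by
    intro X Y
    rw [← Finset.card_sdiff_add_card_inter (A ∩ X) Y, Finset.inter_sdiff_assoc,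
      Finset.inter_assoc]
  rw [key W W', key W' W, Finset.inter_comm W' W]
  omega

/-- A random agent strictly prefers `W'` to a committee of top alternatives with probability
less than `|W'| / k`. -/
lemma iadExp_prefers_lt {m k : ℕ} (hk : 1 ≤ k) {p : Fin m → ℝ} (hp : ∀ i, 0 ≤ p i ∧ p i ≤ 1)
    {W W' : Finset (Fin m)} (hW : W ∈ topk m k p) (hW' : W'.Nonempty) :
    iadExp p (fun A => if (A ∩ W).card < (A ∩ W').card then 1 else 0) < W'.card / k := by
  obtain ⟨hcard, htop⟩ := (Finset.mem_filter.mp hW).2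
  have hk0 : (0 : ℝ) < k := by exact_mod_cast hk
  simp only [card_inter_lt_iff_sdiff _ W W']
  rcases (W' \ W).eq_empty_or_nonempty with h | h
  · have : (0 : ℝ) < W'.card := by exact_mod_cast hW'.card_pos
    simp only [h, Finset.inter_empty, Finset.card_empty, not_lt_zero, if_false, iadExp,
      mul_zero, Finset.sum_const_zero]
    positivity
  · have hle := iadExp_beats_le hp (V := W' \ W) (U := W \ W')
      (disjoint_sdiff_sdiff) h fun v hv u hu =>
        htop u (Finset.mem_sdiff.mp hu).1 v (Finset.mem_sdiff.mp hv).2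
    set r := (W \ W').card / (W' \ W).card
    have hlt : k < (r + 1) * W'.card := by
      have h1 := Finset.card_sdiff_add_card_inter W W'
      have h2 := Finset.card_sdiff_add_card_inter W' W
      rw [Finset.inter_comm] at h2
      have h3 : (W \ W').card < (r + 1) * (W' \ W).card :=
        Nat.lt_mul_of_div_lt (Nat.lt_succ_self _) h.card_pos
      rw [← h2, mul_add]
      nlinarith
    have hlt' : (k : ℝ) < (r + 1) * W'.card := by exact_mod_cast hlt
    rw [lt_div_iff₀ hk0]
    have hr : (0 : ℝ) < r + 1 := by positivity
    refine lt_of_mul_lt_mul_left ?_ hr.le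
    calc _ = ((r + 1 : ℝ) * iadExp p _) * k := by rw [mul_assoc]
      _ ≤ 1 * k := mul_le_mul_of_nonneg_right hle hk0.le
      _ < _ := by rwa [one_mul]

lemma sum_prod_profile {m n : ℕ} (p : Fin m → ℝ) (f : Finset (Fin m) → ℝ) :
    ∑ P : Fin n → Finset (Fin m), ∏ j, (iadProb m p (P j) * f (P j)) = iadExp p f ^ n := by
  have := Finset.prod_univ_sum (fun _ : Fin n => (Finset.univ : Finset (Finset (Fin m))))
    (fun _ A => iadProb m p A * f A)
  rw [Fintype.piFinset_univ] at this
  simp [← this, iadExp]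

lemma prIAD_mono {m n : ℕ} {p : Fin m → ℝ} (hp : ∀ i, 0 ≤ p i ∧ p i ≤ 1)
    {E F : (Fin n → Finset (Fin m)) → Prop} (h : ∀ P, E P → F P) :
    prIAD m n p E ≤ prIAD m n p F := by
  refine Finset.sum_le_sum fun P _ => ?_
  have : 0 ≤ ∏ j, iadProb m p (P j) := Finset.prod_nonneg fun j _ => iadProb_nonneg hp _
  by_cases hE : E P
  · rw [if_pos hE, if_pos (h P hE)]
  · rw [if_neg hE]
    split_ifs
    · exact this
    · rfl

lemma prIAD_compl {m n : ℕ} (p : Fin m → ℝ) (E : (Fin n → Finset (Fin m)) → Prop) :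
    prIAD m n p E = 1 - prIAD m n p (fun P => ¬ E P) := by
  have h := sum_prod_profile (n := n) p fun _ => 1
  rw [iadExp_one, one_pow] at h
  rw [eq_sub_iff_add_eq, prIAD, prIAD, ← Finset.sum_add_distrib, ← h]
  refine Finset.sum_congr rfl fun P _ => ?_
  by_cases hE : E P <;> simp [hE]

lemma prIAD_exists_le {m n : ℕ} {ι : Type*} [Fintype ι] {p : Fin m → ℝ}
    (hp : ∀ i, 0 ≤ p i ∧ p i ≤ 1) (E : ι → (Fin n → Finset (Fin m)) → Prop) :
    prIAD m n p (fun P => ∃ x, E x P) ≤ ∑ x, prIAD m n p (E x) := by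
  classical
  unfold prIAD
  rw [Finset.sum_comm]
  refine Finset.sum_le_sum fun P _ => ?_
  have h0 : 0 ≤ ∏ j, iadProb m p (P j) := Finset.prod_nonneg fun j _ => iadProb_nonneg hp _
  have hnn : ∀ x ∈ Finset.univ, 0 ≤ if E x P then ∏ j, iadProb m p (P j) else 0 := by
    intro x _
    split_ifs
    · exact h0
    · rfl
  split_ifs with h
  · obtain ⟨x, hx⟩ := h
    refine le_trans ?_ (Finset.single_le_sum hnn (Finset.mem_univ x))
    rw [if_pos hx]
  · exact Finset.sum_nonneg hnn

lemma exists_pos_exp_moment_lt_one {x θ : ℝ} (h : x < θ) :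
    ∃ t > 0, Real.exp (-(t * θ)) * (1 - x + x * Real.exp t) < 1 := by
  have hd : HasDerivAt (fun t : ℝ => Real.exp (-(t * θ)) * (1 - x + x * Real.exp t))
      (x - θ) 0 := by
    have h1 : HasDerivAt (fun t : ℝ => Real.exp (-(t * θ))) (Real.exp (-(0 * θ)) * -(1 * θ)) 0 :=
      (((hasDerivAt_id (0 : ℝ)).mul_const θ).neg).exp
    have h2 : HasDerivAt (fun t : ℝ => 1 - x + x * Real.exp t) (x * Real.exp 0) 0 :=
      ((Real.hasDerivAt_exp 0).const_mul x).const_add (1 - x)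
    exact (h1.mul h2).congr_deriv (by simp; ring)
  have hev := (hasDerivAt_iff_tendsto_slope.mp hd).eventually (gt_mem_nhds (sub_neg.mpr h))
  have hev' : ∀ᶠ t in nhdsWithin (0 : ℝ) (Set.Ioi 0), slope
      (fun t : ℝ => Real.exp (-(t * θ)) * (1 - x + x * Real.exp t)) 0 t < 0 :=
    hev.filter_mono (nhdsWithin_mono _ fun t ht => ne_of_gt ht)
  obtain ⟨t, hts, ht⟩ := (hev'.and self_mem_nhdsWithin).exists
  have ht0 : (0 : ℝ) < t := ht
  refine ⟨t, ht0, ?_⟩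
  rw [slope_def_field, sub_zero, div_neg_iff] at hts
  rcases hts with ⟨_, h⟩ | ⟨h, _⟩
  · exact absurd h (not_lt.mpr ht0.le)
  · simpa using h

/-- Chernoff bound for the number of agents whose preference satisfies `B`. -/
lemma exists_prIAD_count_le_exp {m : ℕ} {p : Fin m → ℝ} (hp : ∀ i, 0 ≤ p i ∧ p i ≤ 1)
    (B : Finset (Fin m) → Prop) [DecidablePred B] {θ : ℝ} (hB : iadExp p (fun A => if B A then 1 else 0) < θ) :
    ∃ c > 0, ∀ n : ℕ, prIAD m n p
      (fun P => θ * n ≤ (Finset.univ.filter fun j => B (P j)).card) ≤ Real.exp (-(c * n)) := by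
  obtain ⟨t, ht, hlt⟩ := exists_pos_exp_moment_lt_one hB
  set x := iadExp p (fun A => if B A then 1 else 0) with hx
  have hx0 : 0 ≤ x := Finset.sum_nonneg fun A _ =>
    mul_nonneg (iadProb_nonneg hp A) (by dsimp only; split_ifs <;> norm_num)
  have hmom : iadExp p (fun A => Real.exp (t * ((if B A then 1 else 0) - θ))) =
      Real.exp (-(t * θ)) * (1 - x + x * Real.exp t) := by
    have h : (fun A => Real.exp (t * ((if B A then 1 else 0) - θ))) =
        fun A => Real.exp (-(t * θ)) * (1 + (Real.exp t - 1) * (if B A then 1 else 0)) := by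
      funext A
      split_ifs
      · rw [mul_one, add_sub_cancel, ← Real.exp_add]
        ring_nf
      · simp
    have hx' : 1 - x + x * Real.exp t = 1 + (Real.exp t - 1) * x := by ring
    rw [h, hx', iadExp_mul_one_add]
  set φ := Real.exp (-(t * θ)) * (1 - x + x * Real.exp t)
  have hφ : 0 < φ := by
    have : 1 ≤ Real.exp t := Real.one_le_exp ht.le
    have : 0 < 1 - x + x * Real.exp t := by nlinarith
    positivity
  refine ⟨-Real.log φ, neg_pos.mpr (Real.log_neg hφ hlt), fun n => ?_⟩
  have hexp : Real.exp (-(-Real.log φ * n)) = φ ^ n := by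
    rw [neg_mul, neg_neg, mul_comm, Real.exp_nat_mul, Real.exp_log hφ]
  rw [hexp, ← hmom, ← sum_prod_profile]
  refine Finset.sum_le_sum fun P _ => ?_
  have h0 : 0 ≤ ∏ j, iadProb m p (P j) := Finset.prod_nonneg fun j _ => iadProb_nonneg hp _
  rw [Finset.prod_mul_distrib, ← Real.exp_sum, ← Finset.mul_sum, Finset.sum_sub_distrib,
    Finset.sum_boole]
  split_ifs with h
  · refine le_mul_of_one_le_right h0 (Real.one_le_exp (mul_nonneg ht.le ?_))
    simp only [Finset.sum_const, Finset.card_univ, Fintype.card_fin, nsmul_eq_mul]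
    linarith
  · positivity

/-- The profiles in which a nonempty coalition deviating to `W'` blocks `W ∈ topk m k p`
are exponentially unlikely. -/
lemma exists_prIAD_blocked_le_exp {m k : ℕ} (hk : 1 ≤ k) {p : Fin m → ℝ}
    (hp : ∀ i, 0 ≤ p i ∧ p i ≤ 1) (W W' : Finset (Fin m)) :
    ∃ c > 0, ∀ n : ℕ, prIAD m n p (fun P => W ∈ topk m k p ∧ ∃ S : Finset (Fin n), S.Nonempty ∧
      W'.card * n ≤ S.card * k ∧ ∀ j ∈ S, (P j ∩ W).card < (P j ∩ W').card) ≤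
        Real.exp (-(c * n)) := by
  by_cases h : W ∈ topk m k p ∧ W'.Nonempty
  · obtain ⟨hW, hW'⟩ := h
    obtain ⟨c, hc, hle⟩ := exists_prIAD_count_le_exp hp
      (fun A => (A ∩ W).card < (A ∩ W').card) (iadExp_prefers_lt hk hp hW hW')
    refine ⟨c, hc, fun n => (prIAD_mono hp ?_).trans (hle n)⟩
    rintro P ⟨-, S, -, hS, hpref⟩
    have hk0 : (0 : ℝ) < k := by exact_mod_cast hk
    have hsub : S.card ≤ (Finset.univ.filter fun j => (P j ∩ W).card < (P j ∩ W').card).card :=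
      Finset.card_le_card fun j hj => by simpa using hpref j hj
    rw [div_mul_eq_mul_div, div_le_iff₀ hk0]
    exact_mod_cast hS.trans (Nat.mul_le_mul_right k hsub)
  · refine ⟨1, one_pos, fun n => le_trans (le_of_eq ?_) (Real.exp_pos _).le⟩
    refine Finset.sum_eq_zero fun P _ => if_neg ?_
    rintro ⟨hW, S, ⟨j, hj⟩, -, hpref⟩
    have hW' : W' = ∅ := Finset.not_nonempty_iff_eq_empty.mp fun hW' => h ⟨hW, hW'⟩
    simpa [hW'] using hpref j hj

/-- under any independent approval distribution with
`p⃗ ∈ (0,1)^m`, the probability that every committee in `top_k(p⃗)` is in the core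
is at least `1 − C·e^{−cn}`. -/
theorem topk_in_core (m k : ℕ) (hk : 1 ≤ k) (hkm : k < m)
    (p : Fin m → ℝ) (hp : ∀ i, 0 < p i ∧ p i < 1) :
    ∃ c C : ℝ, 0 < c ∧ 0 < C ∧ ∀ n : ℕ, 1 ≤ n →
      1 - C * Real.exp (-(c * n)) ≤
        prIAD m n p (fun P => ∀ W ∈ topk m k p, inCore m k n P W) := by
  have hp' : ∀ i, 0 ≤ p i ∧ p i ≤ 1 := fun i => ⟨(hp i).1.le, (hp i).2.le⟩
  choose c hc hle using fun z : Finset (Fin m) × Finset (Fin m) =>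
    exists_prIAD_blocked_le_exp hk hp' z.1 z.2
  obtain ⟨z₀, hz₀⟩ := Finite.exists_min c
  refine ⟨c z₀, Fintype.card (Finset (Fin m) × Finset (Fin m)), hc z₀,
    by exact_mod_cast Fintype.card_pos, fun n _ => ?_⟩
  rw [prIAD_compl]
  refine sub_le_sub_left ?_ 1
  refine (prIAD_mono hp' ?_).trans ((prIAD_exists_le hp' _).trans
    ((Finset.sum_le_card_nsmul Finset.univ _ (Real.exp (-(c z₀ * n))) fun z _ =>
      (hle z n).trans ?_).trans_eq ?_))
  · intro P hP
    simp only [inCore] at hP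
    push Not at hP
    obtain ⟨W, hW, S, W', hS, hcard, hpref⟩ := hP
    exact ⟨(W, W'), hW, S, hS, hcard, hpref⟩
  · exact Real.exp_le_exp.mpr (neg_le_neg
      (mul_le_mul_of_nonneg_right (hz₀ z) (Nat.cast_nonneg n)))
  · rw [nsmul_eq_mul, Finset.card_univ]
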